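/- Let g ∈ S₀(ℝ), let α, β > 0 be such that (g, αℤ×βℤ) is a frame sequence with closed linear span 𝒢 = 𝒢(g, αℤ×βℤ) and canonical dual window γ, and let ν ∈ ℕ, ν ≥ 1. If for every s = 0, …, ν−1 one has (αβ)^{−1} ∑_{k,ℓ∈ℤ} ⟨M_{s/α} g, T_{k/β} M_{ℓν/α} γ⟩ T_{k/β} M_{ℓν/α} g = g for s = 0 and = 0 for s ≠ 0 (the sums converging unconditionally in L²), then T_{α/ν} g ∈ 𝒢. -/

import Mathlib

open MeasureTheory Complex Filter
open scoped ENNReal InnerProductSpace RealInnerProductSpace ComplexConjugate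

noncomputable section

/-- The Hilbert space `L²(ℝ)` of complex-valued square-integrable functions. -/
abbrev L2 : Type := Lp ℂ 2 (volume : Measure ℝ)

lemma memLp_translate (a : ℝ) (f : L2) :
    MemLp (fun x : ℝ => f (x - a)) 2 (volume : Measure ℝ) :=
  (Lp.memLp f).comp_measurePreserving (measurePreserving_sub_right volume a)

lemma memLp_modulate (b : ℝ) (f : L2) :
    MemLp (fun x : ℝ => Complex.exp (2 * Real.pi * Complex.I * (b * x)) * f x) 2
      (volume : Measure ℝ) := by
  refine MemLp.of_le (Lp.memLp f) ?_ ?_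
  · exact (Complex.continuous_exp.comp (by fun_prop)).aestronglyMeasurable.mul
      (Lp.aestronglyMeasurable f)
  · filter_upwards with x
    have : Complex.exp (2 * Real.pi * Complex.I * (b * x))
        = Complex.exp ((2 * Real.pi * (b * x) : ℝ) * Complex.I) := by
      push_cast; ring_nf
    rw [norm_mul, this, Complex.norm_exp_ofReal_mul_I, one_mul]

/-- Translation `T_a` on `L²(ℝ)`: `(T_a f)(x) = f (x - a)`. -/
def Tr (a : ℝ) (f : L2) : L2 := (memLp_translate a f).toLp _

/-- Modulation `M_b` on `L²(ℝ)`: `(M_b f)(x) = e^{2πibx} f x`. -/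
def Mo (b : ℝ) (f : L2) : L2 := (memLp_modulate b f).toLp _

/-- Time-frequency shift `π(a,b) = T_a M_b`. -/
def tf (z : ℝ × ℝ) (f : L2) : L2 := Tr z.1 (Mo z.2 f)

/-- The closed linear span `𝒢(g,Λ)` of the Gabor system `(g,Λ)`. -/
def gaborSpan (g : L2) (Λ : Set (ℝ × ℝ)) : Set L2 :=
  closure (Submodule.span ℂ ((fun z => tf z g) '' Λ) : Set L2)

/-- `𝔍(𝒢)`: the set of time-frequency shifts leaving `𝒢` invariant. -/
def stab (G : Set L2) : Set (ℝ × ℝ) := {z | ∀ f ∈ G, tf z f ∈ G}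

/-- `Λ` is a lattice in `ℝ²` if `Λ = Aℤ²` for an invertible `2×2` matrix `A`. -/
def IsLattice (Λ : Set (ℝ × ℝ)) : Prop :=
  ∃ A : Matrix (Fin 2) (Fin 2) ℝ, IsUnit A.det ∧
    Λ = {p : ℝ × ℝ | ∃ k l : ℤ,
      p = (A 0 0 * k + A 0 1 * l, A 1 0 * k + A 1 1 * l)}

lemma memLp_gaussian : MemLp (fun x : ℝ => (Real.exp (-Real.pi * x ^ 2) : ℂ)) 2
    (volume : Measure ℝ) := by
  rw [memLp_two_iff_integrable_sq_norm]
  · have h : Integrable (fun x : ℝ => Real.exp (-(2 * Real.pi) * x ^ 2)) volume :=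
      integrable_exp_neg_mul_sq (by positivity)
    refine h.congr (Eventually.of_forall fun x => ?_)
    simp only [Complex.norm_real, Real.norm_eq_abs, Real.abs_exp, sq, ← Real.exp_add]
    ring_nf
  · exact (Complex.continuous_ofReal.comp (by fun_prop)).aestronglyMeasurable

/-- The Gaussian `φ(x) = e^{-πx²}` as an element of `L²(ℝ)`. -/
def gaussL2 : L2 := memLp_gaussian.toLp _

/-- The Feichtinger algebra condition: `f ∈ S₀(ℝ)` iff `(a,b) ↦ ⟨f, π(a,b)φ⟩ ∈ L¹(ℝ²)`. -/
def InS0 (f : L2) : Prop :=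
  Integrable (fun z : ℝ × ℝ => ⟪tf z gaussL2, f⟫_ℂ) (volume : Measure (ℝ × ℝ))

/-- `(g,Λ)` is a frame for its closed linear span. -/
def IsFrameSeq (g : L2) (Λ : Set (ℝ × ℝ)) : Prop :=
  ∃ A B : ℝ, 0 < A ∧ 0 < B ∧ ∀ f ∈ gaborSpan g Λ,
    A * ‖f‖ ^ 2 ≤ ∑' lam : Λ, ‖⟪tf (lam : ℝ × ℝ) g, f⟫_ℂ‖ ^ 2 ∧
    ∑' lam : Λ, ‖⟪tf (lam : ℝ × ℝ) g, f⟫_ℂ‖ ^ 2 ≤ B * ‖f‖ ^ 2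

/-- `(g,Λ)` is a frame for all of `L²(ℝ)`. -/
def IsFrameL2 (g : L2) (Λ : Set (ℝ × ℝ)) : Prop :=
  ∃ A B : ℝ, 0 < A ∧ 0 < B ∧ ∀ f : L2,
    A * ‖f‖ ^ 2 ≤ ∑' lam : Λ, ‖⟪tf (lam : ℝ × ℝ) g, f⟫_ℂ‖ ^ 2 ∧
    ∑' lam : Λ, ‖⟪tf (lam : ℝ × ℝ) g, f⟫_ℂ‖ ^ 2 ≤ B * ‖f‖ ^ 2

/-- Euclidean ball of radius `ε` around `a ∈ ℝ²`. -/
def eball (ε : ℝ) (a : ℝ × ℝ) : Set (ℝ × ℝ) :=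
  {x : ℝ × ℝ | Real.sqrt ((x.1 - a.1) ^ 2 + (x.2 - a.2) ^ 2) < ε}

/-- `B_ε(Δ) = ⋃_{a ∈ Δ} B_ε(a)`. -/
def eballSet (ε : ℝ) (Δ : Set (ℝ × ℝ)) : Set (ℝ × ℝ) := ⋃ a ∈ Δ, eball ε a

/-- The separable lattice `αℤ × βℤ`. -/
def sepLattice (α β : ℝ) : Set (ℝ × ℝ) :=
  {p : ℝ × ℝ | ∃ k l : ℤ, p = (α * k, β * l)}


/-- `γ` is the canonical dual window of the frame sequence `(g, αℤ×βℤ)`: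
`γ` belongs to `𝒢(g, αℤ×βℤ)` and `Sγ = g` for the frame operator `S`,
the defining series converging unconditionally in `L²`. -/
def IsDualWindow (g γ : L2) (α β : ℝ) : Prop :=
  γ ∈ gaborSpan g (sepLattice α β) ∧
  HasSum (fun lam : sepLattice α β =>
    ⟪tf (lam : ℝ × ℝ) g, γ⟫_ℂ • tf (lam : ℝ × ℝ) g) g

/-- The character `x ↦ e^{2πix}`. -/
def ex (x : ℝ) : ℂ := Complex.exp (2 * Real.pi * Complex.I * x)

lemma ex_eq (x : ℝ) : ex x = Complex.exp ((2 * Real.pi * x : ℝ) * Complex.I) := by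
  unfold ex; push_cast; ring_nf

@[simp] lemma norm_ex (x : ℝ) : ‖ex x‖ = 1 := by
  rw [ex_eq, Complex.norm_exp_ofReal_mul_I]

lemma ex_add (x y : ℝ) : ex (x + y) = ex x * ex y := by
  unfold ex; rw [← Complex.exp_add]; push_cast; ring_nf

@[simp] lemma ex_zero : ex 0 = 1 := by simp [ex]

lemma ex_int (n : ℤ) : ex n = 1 := by
  rw [ex, Complex.exp_eq_one_iff]
  exact ⟨n, by push_cast; ring⟩

lemma conj_ex (x : ℝ) : conj (ex x) = ex (-x) := by
  rw [ex_eq, ex_eq, ← Complex.exp_conj, map_mul, Complex.conj_ofReal, Complex.conj_I]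
  push_cast; ring_nf

lemma conj_ex_mul_ex (x : ℝ) : conj (ex x) * ex x = 1 := by
  rw [conj_ex, ← ex_add]; simp

lemma continuous_ex : Continuous ex := by unfold ex; fun_prop

lemma coeFn_Tr (a : ℝ) (f : L2) : Tr a f =ᵐ[volume] fun x => f (x - a) :=
  MemLp.coeFn_toLp _

lemma coeFn_Mo (b : ℝ) (f : L2) : Mo b f =ᵐ[volume] fun x => ex (b * x) * f x := by
  refine (MemLp.coeFn_toLp (memLp_modulate b f)).trans (Eventually.of_forall fun x => ?_)
  simp [ex]

lemma ae_comp_sub {p : ℝ → Prop} (h : ∀ᵐ x, p x) (a : ℝ) : ∀ᵐ x : ℝ, p (x - a) :=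
  (measurePreserving_sub_right volume a).quasiMeasurePreserving.ae h

lemma coeFn_tf (a b : ℝ) (f : L2) :
    tf (a, b) f =ᵐ[volume] fun x => ex (b * (x - a)) * f (x - a) :=
  (coeFn_Tr a _).trans (ae_comp_sub (coeFn_Mo b f) a)

lemma Tr_Tr (a b : ℝ) (f : L2) : Tr a (Tr b f) = Tr (a + b) f := by
  apply Lp.ext
  filter_upwards [coeFn_Tr a (Tr b f), ae_comp_sub (coeFn_Tr b f) a, coeFn_Tr (a + b) f]
    with x h1 h2 h3
  rw [h1, h2, h3, sub_sub]

lemma Mo_Mo (a b : ℝ) (f : L2) : Mo a (Mo b f) = Mo (a + b) f := by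
  apply Lp.ext
  filter_upwards [coeFn_Mo a (Mo b f), coeFn_Mo b f, coeFn_Mo (a + b) f] with x h1 h2 h3
  rw [h1, h2, h3, add_mul, ex_add, mul_assoc]

lemma Mo_Tr (a b : ℝ) (f : L2) : Mo b (Tr a f) = ex (a * b) • Tr a (Mo b f) := by
  apply Lp.ext
  filter_upwards [coeFn_Mo b (Tr a f), coeFn_Tr a f, coeFn_Tr a (Mo b f),
    ae_comp_sub (coeFn_Mo b f) a, Lp.coeFn_smul (ex (a * b)) (Tr a (Mo b f))] with x h1 h2 h3 h4 h5
  rw [h1, h2, h5, Pi.smul_apply, h3, h4, smul_eq_mul, ← mul_assoc, ← ex_add]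
  ring_nf

lemma Tr_smul (a : ℝ) (c : ℂ) (f : L2) : Tr a (c • f) = c • Tr a f := by
  apply Lp.ext
  filter_upwards [coeFn_Tr a (c • f), coeFn_Tr a f, ae_comp_sub (Lp.coeFn_smul c f) a,
    Lp.coeFn_smul c (Tr a f)] with x h1 h2 h3 h4
  rw [h1, h3, h4, Pi.smul_apply, Pi.smul_apply, h2]

lemma Tr_sub (a : ℝ) (f g : L2) : Tr a (f - g) = Tr a f - Tr a g := by
  apply Lp.ext
  filter_upwards [coeFn_Tr a (f - g), coeFn_Tr a f, coeFn_Tr a g,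
    ae_comp_sub (Lp.coeFn_sub f g) a, Lp.coeFn_sub (Tr a f) (Tr a g)] with x h1 h2 h3 h4 h5
  rw [h1, h4, h5, Pi.sub_apply, Pi.sub_apply, h2, h3]

lemma Mo_sub (a : ℝ) (f g : L2) : Mo a (f - g) = Mo a f - Mo a g := by
  apply Lp.ext
  filter_upwards [coeFn_Mo a (f - g), coeFn_Mo a f, coeFn_Mo a g, Lp.coeFn_sub f g,
    Lp.coeFn_sub (Mo a f) (Mo a g)] with x h1 h2 h3 h4 h5
  rw [h1, h4, h5, Pi.sub_apply, Pi.sub_apply, h2, h3, mul_sub]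

@[simp] lemma Tr_zero (f : L2) : Tr 0 f = f := by
  apply Lp.ext
  filter_upwards [coeFn_Tr 0 f] with x h1
  rw [h1, sub_zero]

@[simp] lemma Mo_zero (f : L2) : Mo 0 f = f := by
  apply Lp.ext
  filter_upwards [coeFn_Mo 0 f] with x h1
  simp [h1]

lemma inner_L2 (f g : L2) : ⟪f, g⟫_ℂ = ∫ x, conj (f x) * g x := by
  rw [L2.inner_def]
  exact integral_congr_ae (Eventually.of_forall fun x => by simp [mul_comm])

lemma inner_Tr (a : ℝ) (f g : L2) : ⟪Tr a f, g⟫_ℂ = ⟪f, Tr (-a) g⟫_ℂ := by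
  rw [inner_L2, inner_L2, ← integral_sub_right_eq_self (fun x => conj (f x) * Tr (-a) g x) a]
  refine integral_congr_ae ?_
  filter_upwards [coeFn_Tr a f, ae_comp_sub (coeFn_Tr (-a) g) a] with x h1 h2
  rw [h1, h2]; simp

lemma inner_Mo (a : ℝ) (f g : L2) : ⟪Mo a f, g⟫_ℂ = ⟪f, Mo (-a) g⟫_ℂ := by
  rw [inner_L2, inner_L2]
  refine integral_congr_ae ?_
  filter_upwards [coeFn_Mo a f, coeFn_Mo (-a) g] with x h1 h2
  rw [h1, h2, map_mul, conj_ex, neg_mul]; ring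

@[simp] lemma norm_Tr (a : ℝ) (f : L2) : ‖Tr a f‖ = ‖f‖ := by
  have h : ⟪Tr a f, Tr a f⟫_ℂ = ⟪f, f⟫_ℂ := by rw [inner_Tr, Tr_Tr]; simp
  rw [@norm_eq_sqrt_re_inner ℂ, h, ← @norm_eq_sqrt_re_inner ℂ]

@[simp] lemma norm_Mo (a : ℝ) (f : L2) : ‖Mo a f‖ = ‖f‖ := by
  have h : ⟪Mo a f, Mo a f⟫_ℂ = ⟪f, f⟫_ℂ := by rw [inner_Mo, Mo_Mo]; simp
  rw [@norm_eq_sqrt_re_inner ℂ, h, ← @norm_eq_sqrt_re_inner ℂ]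

/-- The time-frequency shift by a sum is the composition up to a phase. -/
lemma tf_add (a b c d : ℝ) (f : L2) :
    tf (a + c, b + d) f = ex (-(b * c)) • tf (a, b) (tf (c, d) f) := by
  simp only [tf, Mo_Tr, Tr_smul, smul_smul, Tr_Tr, Mo_Mo]
  rw [← ex_add]; simp [mul_comm]

lemma inner_tf (a b : ℝ) (f g : L2) : ⟪tf (a, b) f, g⟫_ℂ = ⟪f, Mo (-b) (Tr (-a) g)⟫_ℂ := by
  simp only [tf, inner_Tr, inner_Mo]

@[simp] lemma norm_tf (z : ℝ × ℝ) (f : L2) : ‖tf z f‖ = ‖f‖ := by simp [tf]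

/-- Translations are strongly continuous. -/
lemma continuous_Tr (f : L2) : Continuous fun a => Tr a f := by
  have h : ∀ a : ℝ, Tr a f = DomAddAct.mk (-a) +ᵥ f := fun a => by
    apply Lp.ext
    filter_upwards [coeFn_Tr a f, DomAddAct.vadd_Lp_ae_eq (DomAddAct.mk (-a)) f] with x h1 h2
    rw [h1, h2]
    simp [sub_eq_neg_add]
  simp_rw [h]
  have : Fact ((2 : ℝ≥0∞) ≠ ∞) := ⟨ENNReal.ofNat_ne_top⟩
  have hc : Continuous fun a : ℝ => DomAddAct.mk (-a) :=
    DomAddAct.continuous_mk.comp continuous_neg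
  exact hc.vadd continuous_const

lemma integrable_normSq (f : L2) : Integrable (fun x => ‖f x‖ ^ 2) := by
  exact (memLp_two_iff_integrable_sq_norm (Lp.aestronglyMeasurable f)).1 (Lp.memLp f)

lemma continuous_inner_Mo_self (f : L2) : Continuous fun b => ⟪f, Mo b f⟫_ℂ := by
  have h : ∀ b, ⟪f, Mo b f⟫_ℂ = ∫ x, ex (b * x) * ((‖f x‖ ^ 2 : ℝ) : ℂ) := fun b => by
    rw [inner_L2]
    refine integral_congr_ae ?_
    filter_upwards [coeFn_Mo b f] with x hx
    rw [hx, mul_left_comm, Complex.conj_mul', Complex.ofReal_pow]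
  simp_rw [h]
  refine continuous_of_dominated (bound := fun x => ‖f x‖ ^ 2) (fun b => ?_) (fun b => ?_)
    (integrable_normSq f) ?_
  · exact (continuous_ex.comp (continuous_const.mul continuous_id)).aestronglyMeasurable.mul
      (Complex.continuous_ofReal.comp_aestronglyMeasurable (integrable_normSq f).1)
  · filter_upwards with x
    simp
  · filter_upwards with x
    exact (continuous_ex.comp (continuous_id.mul continuous_const)).mul continuous_const

/-- Modulations are strongly continuous. -/
lemma continuous_Mo (f : L2) : Continuous fun b => Mo b f := by
  rw [continuous_iff_continuousAt]
  intro b₀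
  rw [ContinuousAt, tendsto_iff_norm_sub_tendsto_zero]
  have h : ∀ b, ‖Mo b f - Mo b₀ f‖ ^ 2 = 2 * ‖f‖ ^ 2 - 2 * (⟪f, Mo (b - b₀) f⟫_ℂ).re := fun b => by
    rw [← norm_neg, neg_sub, @norm_sub_sq ℂ, norm_Mo, norm_Mo, inner_Mo, Mo_Mo,
      neg_add_eq_sub]
    simp only [RCLike.re_to_complex]
    ring
  have h2 : Tendsto (fun b => ‖Mo b f - Mo b₀ f‖ ^ 2) (nhds b₀) (nhds 0) := by
    simp_rw [h]
    have hc : Continuous fun b => 2 * ‖f‖ ^ 2 - 2 * (⟪f, Mo (b - b₀) f⟫_ℂ).re :=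
      continuous_const.sub (continuous_const.mul (Complex.continuous_re.comp
        ((continuous_inner_Mo_self f).comp (continuous_id.sub continuous_const))))
    convert hc.tendsto b₀ using 2
    have h0 := @inner_self_eq_norm_sq ℂ L2 _ _ _ f
    simp only [RCLike.re_to_complex] at h0
    rw [sub_self, Mo_zero, h0, sub_self]
  simpa [Function.comp_def, Real.sqrt_sq] using (Real.continuous_sqrt.tendsto 0).comp h2

lemma continuous_Tr_uncurry : Continuous fun p : ℝ × L2 => Tr p.1 p.2 := by
  rw [continuous_iff_continuousAt]
  rintro ⟨a, f⟩
  rw [ContinuousAt, tendsto_iff_norm_sub_tendsto_zero]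
  have h0 : Tendsto (fun p : ℝ × L2 => ‖p.2 - f‖ + ‖Tr p.1 f - Tr a f‖) (nhds (a, f)) (nhds 0) := by
    have hc : Continuous (fun p : ℝ × L2 => ‖p.2 - f‖ + ‖Tr p.1 f - Tr a f‖) :=
      (continuous_snd.sub continuous_const).norm.add
        (((continuous_Tr f).comp continuous_fst).sub continuous_const).norm
    simpa using hc.tendsto (a, f)
  refine squeeze_zero (fun _ => norm_nonneg _) (fun p => ?_) h0
  calc ‖Tr p.1 p.2 - Tr a f‖ = ‖Tr p.1 (p.2 - f) + (Tr p.1 f - Tr a f)‖ := by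
        rw [Tr_sub]; congr 1; abel
    _ ≤ _ := (norm_add_le _ _).trans_eq (by rw [norm_Tr])

lemma continuous_Mo_uncurry : Continuous fun p : ℝ × L2 => Mo p.1 p.2 := by
  rw [continuous_iff_continuousAt]
  rintro ⟨a, f⟩
  rw [ContinuousAt, tendsto_iff_norm_sub_tendsto_zero]
  have h0 : Tendsto (fun p : ℝ × L2 => ‖p.2 - f‖ + ‖Mo p.1 f - Mo a f‖) (nhds (a, f)) (nhds 0) := by
    have hc : Continuous (fun p : ℝ × L2 => ‖p.2 - f‖ + ‖Mo p.1 f - Mo a f‖) :=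
      (continuous_snd.sub continuous_const).norm.add
        (((continuous_Mo f).comp continuous_fst).sub continuous_const).norm
    simpa using hc.tendsto (a, f)
  refine squeeze_zero (fun _ => norm_nonneg _) (fun p => ?_) h0
  calc ‖Mo p.1 p.2 - Mo a f‖ = ‖Mo p.1 (p.2 - f) + (Mo p.1 f - Mo a f)‖ := by
        rw [Mo_sub]; congr 1; abel
    _ ≤ _ := (norm_add_le _ _).trans_eq (by rw [norm_Mo])

lemma continuous_tf (f : L2) : Continuous fun z : ℝ × ℝ => tf z f :=
  continuous_Tr_uncurry.comp (continuous_fst.prodMk ((continuous_Mo f).comp continuous_snd))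

open FourierTransform SchwartzMap in
/-- On `L¹ ∩ L²` the `L²`-Fourier transform is given by the Fourier integral. -/
lemma coeFn_fourier_toLp {F : ℝ → ℂ} (h1 : Integrable F) (h2 : MemLp F 2) :
    (𝓕 (h2.toLp F) : Lp ℂ 2 (volume : Measure ℝ)) =ᵐ[volume] 𝓕 F := by
  refine ae_eq_of_integral_contDiff_smul_eq ((Lp.memLp _).locallyIntegrable (by norm_num))
    (VectorFourier.fourierIntegral_continuous Real.continuous_fourierChar
      (by exact continuous_inner) h1).locallyIntegrable fun φ hφ hφc => ?_
  let ψ : 𝓢(ℝ, ℂ) := (hφc.comp_left (g := ((↑) : ℝ → ℂ)) Complex.ofReal_zero).toSchwartzMap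
    (Complex.ofRealCLM.contDiff.comp hφ)
  have e1 := congrArg (fun D => D ψ) (Lp.fourier_toTemperedDistribution_eq (h2.toLp F))
  simp only [TemperedDistribution.fourier_apply, Lp.toTemperedDistribution_apply] at e1
  have e2 : ∫ ξ, 𝓕 (ψ : ℝ → ℂ) ξ • F ξ = ∫ x, ψ x • 𝓕 F x := by
    simpa using! VectorFourier.integral_fourierIntegral_smul_eq_flip (L := innerₗ ℝ)
      Real.continuous_fourierChar continuous_inner ψ.integrable h1
  calc ∫ x, φ x • (𝓕 (h2.toLp F) : Lp ℂ 2 (volume : Measure ℝ)) x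
      = ∫ x, ψ x • (𝓕 (h2.toLp F) : Lp ℂ 2 (volume : Measure ℝ)) x := rfl
    _ = ∫ ξ, 𝓕 (ψ : ℝ → ℂ) ξ • F ξ := by
        rw [← e1]
        refine integral_congr_ae ?_
        filter_upwards [h2.coeFn_toLp] with x hx
        rw [hx, SchwartzMap.fourier_coe]
    _ = ∫ x, φ x • 𝓕 F x := e2

open FourierTransform in
/-- **Parseval's identity** on `L¹ ∩ L²`. -/
lemma integral_conj_fourier_mul_fourier {F H : ℝ → ℂ} (hF : Integrable F) (hF2 : MemLp F 2)
    (hH : Integrable H) (hH2 : MemLp H 2) :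
    ∫ b, conj (𝓕 H b) * 𝓕 F b = ∫ x, conj (H x) * F x := by
  have h := Lp.inner_fourier_eq (hH2.toLp H) (hF2.toLp F)
  rw [inner_L2, inner_L2] at h
  convert h using 1 <;> apply integral_congr_ae
  · filter_upwards [coeFn_fourier_toLp hF hF2, coeFn_fourier_toLp hH hH2] with x h1 h2
    rw [h1, h2]
  · filter_upwards [hF2.coeFn_toLp, hH2.coeFn_toLp] with x h1 h2
    rw [h1, h2]

open FourierTransform in
lemma fourier_eq_integral_ex (F : ℝ → ℂ) (b : ℝ) : 𝓕 F b = ∫ x, ex (-(b * x)) * F x := by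
  rw [Real.fourier_real_eq_integral_exp_smul]
  refine integral_congr_ae (Eventually.of_forall fun x => ?_)
  simp only [ex_eq, smul_eq_mul]
  congr 4; ring

open FourierTransform in
lemma fourier_comp_sub (F : ℝ → ℂ) (y b : ℝ) :
    𝓕 (fun x => F (x - y)) b = ex (-(y * b)) * 𝓕 F b := by
  rw [fourier_eq_integral_ex, fourier_eq_integral_ex, ← integral_const_mul,
    ← integral_sub_right_eq_self (fun x => ex (-(y * b)) * (ex (-(b * x)) * F x)) y]
  refine integral_congr_ae (Eventually.of_forall fun x => ?_)
  simp only [← mul_assoc, ← ex_add]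
  ring_nf

open FourierTransform in
lemma inner_tf_eq_fourier (a b : ℝ) (u v : L2) :
    ⟪tf (a, b) u, v⟫_ℂ = ex (a * b) * 𝓕 (fun x => conj (u (x - a)) * v x) b := by
  rw [inner_L2, fourier_eq_integral_ex, ← integral_const_mul]
  refine integral_congr_ae ?_
  filter_upwards [coeFn_tf a b u] with x hx
  rw [hx, map_mul, conj_ex, ← mul_assoc, ← mul_assoc, ← ex_add]
  ring_nf

lemma integrable_conj_comp_sub_mul (u v : L2) (a : ℝ) :
    Integrable fun x => conj (u (x - a)) * v x :=
  (memLp_translate a u).star.integrable_mul (Lp.memLp v)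

/-- For almost every shift, the product of an `L²` function with the shift of another one is
square-integrable. -/
lemma ae_memLp_conj_comp_sub_mul (u v : L2) :
    ∀ᵐ a : ℝ, MemLp (fun x => conj (u (x - a)) * v x) 2 := by
  have h : Integrable (fun p : ℝ × ℝ => ‖v p.2‖ ^ 2 * ‖u (-(p.1 - p.2))‖ ^ 2)
      (volume.prod volume) :=
    (integrable_normSq v).convolution_integrand (.mul ℝ ℝ) (integrable_normSq u).comp_neg
  filter_upwards [h.prod_right_ae] with a ha
  rw [memLp_two_iff_integrable_sq_norm (integrable_conj_comp_sub_mul u v a).1]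
  refine ha.congr (Eventually.of_forall fun x => ?_)
  simp [mul_pow, mul_comm]

open FourierTransform in
lemma ae_integral_inner_tf_mul (f g h γ : L2) (y : ℝ) :
    ∀ᵐ a : ℝ, ∫ b, ⟪tf (a, b) γ, f⟫_ℂ * ⟪h, tf (a, b) g⟫_ℂ * ex (-(y * b)) =
      ∫ x, (conj (h x) * f (x - y)) * (conj (γ (x - a - y)) * g (x - a)) := by
  filter_upwards [ae_memLp_conj_comp_sub_mul γ f, ae_memLp_conj_comp_sub_mul g h] with a h1 h2
  have key := integral_conj_fourier_mul_fourier
    ((integrable_conj_comp_sub_mul γ f a).comp_sub_right y)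
    (h1.comp_measurePreserving (measurePreserving_sub_right volume y))
    (integrable_conj_comp_sub_mul g h a) h2
  convert key using 1
  · refine integral_congr_ae (Eventually.of_forall fun b => ?_)
    have hs := fourier_comp_sub (fun x => conj (γ (x - a)) * f x) y b
    simp only at hs ⊢
    rw [hs, ← inner_conj_symm h, inner_tf_eq_fourier, inner_tf_eq_fourier,
      map_mul, conj_ex]
    have : ex (a * b) * ex (-(a * b)) = 1 := by rw [← ex_add]; simp
    linear_combination (𝓕 (fun x => conj (γ (x - a)) * f x) b *
      conj (𝓕 (fun x => conj (g (x - a)) * h x) b) * ex (-(y * b))) * this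
  · refine integral_congr_ae (Eventually.of_forall fun x => ?_)
    simp only [map_mul, Complex.conj_conj, sub_right_comm x a y]
    ring

/-- Fourier transform of a product of two short-time Fourier transforms (**Moyal's identity**). -/
lemma integral_inner_tf_mul (f g h γ : L2) (y ξ : ℝ)
    (hint : Integrable fun z : ℝ × ℝ => ⟪tf z γ, f⟫_ℂ * ⟪h, tf z g⟫_ℂ) :
    ∫ z : ℝ × ℝ, ⟪tf z γ, f⟫_ℂ * ⟪h, tf z g⟫_ℂ * ex (-(ξ * z.1 + y * z.2)) =
      ⟪tf (y, -ξ) γ, g⟫_ℂ * ⟪h, tf (y, -ξ) f⟫_ℂ := by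
  have hint' : Integrable fun z : ℝ × ℝ =>
      ⟪tf z γ, f⟫_ℂ * ⟪h, tf z g⟫_ℂ * ex (-(ξ * z.1 + y * z.2)) := by
    refine hint.mul_bdd (c := 1) ?_ (Eventually.of_forall fun z => (norm_ex _).le)
    exact (continuous_ex.comp (by fun_prop)).aestronglyMeasurable
  let P : ℝ → ℂ := fun x => (conj (h x) * f (x - y)) * ex (-(ξ * x))
  let Q : ℝ → ℂ := fun x => (conj (γ (-x - y)) * g (-x)) * ex (-(ξ * x))
  have hP : Integrable P := by
    refine Integrable.mul_bdd (c := 1) ?_ ?_ (Eventually.of_forall fun z => (norm_ex _).le)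
    · exact (Lp.memLp h).star.integrable_mul (memLp_translate y f)
    · exact (continuous_ex.comp (by fun_prop)).aestronglyMeasurable
  have hQ : Integrable Q := by
    refine Integrable.mul_bdd (c := 1) ?_ ?_ (Eventually.of_forall fun z => (norm_ex _).le)
    · exact (integrable_conj_comp_sub_mul γ g y).comp_neg
    · exact (continuous_ex.comp (by fun_prop)).aestronglyMeasurable
  have step : ∫ z : ℝ × ℝ, ⟪tf z γ, f⟫_ℂ * ⟪h, tf z g⟫_ℂ * ex (-(ξ * z.1 + y * z.2)) =
      ∫ a, ∫ x, P x * Q (a - x) := by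
    rw [Measure.volume_eq_prod, integral_prod _ (by rwa [← Measure.volume_eq_prod])]
    refine integral_congr_ae ?_
    filter_upwards [ae_integral_inner_tf_mul f g h γ y] with a ha
    have e1 : ∀ b, ⟪tf (a, b) γ, f⟫_ℂ * ⟪h, tf (a, b) g⟫_ℂ * ex (-(ξ * a + y * b)) =
        (⟪tf (a, b) γ, f⟫_ℂ * ⟪h, tf (a, b) g⟫_ℂ * ex (-(y * b))) * ex (-(ξ * a)) := fun b => by
      rw [neg_add, ex_add]; ring
    simp only [e1]
    rw [integral_mul_const, ha, ← integral_mul_const]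
    refine integral_congr_ae (Eventually.of_forall fun x => ?_)
    simp only [P, Q, neg_sub]
    have : ex (-(ξ * a)) = ex (-(ξ * x)) * ex (-(ξ * (a - x))) := by rw [← ex_add]; ring_nf
    rw [this]; ring
  rw [step]
  have conv := integral_convolution (L := ContinuousLinearMap.mul ℂ ℂ) hP hQ
  simp only [convolution_def, ContinuousLinearMap.mul_apply'] at conv
  rw [conv]
  have iP : ∫ x, P x = ex (-(ξ * y)) * ⟪h, tf (y, -ξ) f⟫_ℂ := by
    rw [inner_L2, ← integral_const_mul]
    refine integral_congr_ae ?_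
    filter_upwards [coeFn_tf y (-ξ) f] with x hx
    have : ex (-(ξ * x)) = ex (-(ξ * y)) * ex (-ξ * (x - y)) := by rw [← ex_add]; ring_nf
    simp only [P]
    rw [hx, this]; ring
  have iQ : ∫ x, Q x = ex (ξ * y) * ⟪tf (y, -ξ) γ, g⟫_ℂ := by
    rw [← integral_neg_eq_self, inner_L2, ← integral_const_mul]
    refine integral_congr_ae ?_
    filter_upwards [coeFn_tf y (-ξ) γ] with x hx
    have : ex (ξ * x) = ex (ξ * y) * conj (ex (-ξ * (x - y))) := by
      rw [conj_ex, ← ex_add]; ring_nf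
    simp only [Q, neg_neg, mul_neg]
    rw [hx, this, map_mul]; ring
  rw [iP, iQ]
  have : ex (ξ * y) * ex (-(ξ * y)) = 1 := by rw [← ex_add]; simp
  linear_combination (⟪tf (y, -ξ) γ, g⟫_ℂ * ⟪h, tf (y, -ξ) f⟫_ℂ) * this

/-- The half-open unit square with lower left corner `p`. -/
def unitSquare (p : ℤ × ℤ) : Set (ℝ × ℝ) :=
  Set.Ioc (p.1 : ℝ) (p.1 + 1) ×ˢ Set.Ioc (p.2 : ℝ) (p.2 + 1)

/-- The embedding of `ℤ²` into `ℝ²`. -/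
def latticePt (p : ℤ × ℤ) : ℝ × ℝ := ((p.1 : ℝ), (p.2 : ℝ))

lemma measurableSet_unitSquare (p : ℤ × ℤ) : MeasurableSet (unitSquare p) :=
  measurableSet_Ioc.prod measurableSet_Ioc

lemma iUnion_unitSquare : ⋃ p, unitSquare p = Set.univ := by
  ext z
  have h1 : z.1 ∈ ⋃ n : ℤ, Set.Ioc (n : ℝ) (n + 1) := by
    rw [iUnion_Ioc_intCast]; trivial
  have h2 : z.2 ∈ ⋃ n : ℤ, Set.Ioc (n : ℝ) (n + 1) := by
    rw [iUnion_Ioc_intCast]; trivial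
  obtain ⟨k, hk⟩ := Set.mem_iUnion.1 h1
  obtain ⟨l, hl⟩ := Set.mem_iUnion.1 h2
  simp only [Set.mem_iUnion, Set.mem_univ, iff_true]
  exact ⟨(k, l), hk, hl⟩

lemma pairwise_disjoint_unitSquare : Pairwise (Function.onFun Disjoint unitSquare) := by
  intro p q hpq
  have hd := Set.pairwise_disjoint_Ioc_intCast ℝ
  by_cases h : p.1 = q.1
  · have h2 : p.2 ≠ q.2 := fun h2 => hpq (Prod.ext h h2)
    exact Set.disjoint_prod.2 (Or.inr (hd h2))
  · exact Set.disjoint_prod.2 (Or.inl (hd h))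

lemma preimage_unitSquare (p : ℤ × ℤ) :
    (fun z => z + latticePt p) ⁻¹' unitSquare p = unitSquare 0 := by
  ext z
  simp only [unitSquare, latticePt, Set.mem_preimage, Set.mem_prod, Set.mem_Ioc, Prod.fst_add,
    Prod.snd_add, Prod.fst_zero, Prod.snd_zero, Int.cast_zero]
  constructor <;> rintro ⟨⟨h1, h2⟩, h3, h4⟩ <;> refine ⟨⟨?_, ?_⟩, ?_, ?_⟩ <;> linarith

lemma lintegral_eq_tsum_unitSquare (f : ℝ × ℝ → ℝ≥0∞) :
    ∫⁻ z, f z = ∑' p, ∫⁻ z in unitSquare 0, f (z + latticePt p) := by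
  rw [← setLIntegral_univ, ← iUnion_unitSquare,
    lintegral_iUnion measurableSet_unitSquare pairwise_disjoint_unitSquare]
  refine tsum_congr fun p => ?_
  rw [← preimage_unitSquare p,
    (measurePreserving_add_right volume (latticePt p)).setLIntegral_comp_preimage_emb
      (MeasurableEquiv.addRight (latticePt p)).measurableEmbedding]

lemma integral_eq_tsum_unitSquare (f : ℝ × ℝ → ℂ) (hf : Integrable f) :
    ∫ z, f z = ∑' p, ∫ z in unitSquare 0, f (z + latticePt p) := by
  rw [← setIntegral_univ, ← iUnion_unitSquare,
    integral_iUnion measurableSet_unitSquare pairwise_disjoint_unitSquare hf.integrableOn]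
  refine tsum_congr fun p => ?_
  rw [← preimage_unitSquare p,
    (measurePreserving_add_right volume (latticePt p)).setIntegral_preimage_emb
      (MeasurableEquiv.addRight (latticePt p)).measurableEmbedding]

lemma integral_eq_integral_tsum (f : ℝ × ℝ → ℂ) (hf : Integrable f) (hc : Continuous f) :
    ∫ z, f z = ∫ z in unitSquare 0, ∑' p, f (z + latticePt p) := by
  rw [integral_eq_tsum_unitSquare f hf, integral_tsum]
  · exact fun p => (by fun_prop : Continuous fun z => f (z + latticePt p)).aestronglyMeasurable
  · rw [← lintegral_eq_tsum_unitSquare fun z => ‖f z‖ₑ]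
    exact hf.2.ne

lemma volume_unitSquare : volume (unitSquare 0) = 1 := by
  simp [unitSquare, Measure.volume_eq_prod]

lemma integrable_of_tsum_le (f : ℝ × ℝ → ℂ) (hc : Continuous f) (K : ℝ)
    (hs : ∀ z, Summable fun p => ‖f (z + latticePt p)‖)
    (hK : ∀ z, ∑' p, ‖f (z + latticePt p)‖ ≤ K) : Integrable f := by
  refine ⟨hc.aestronglyMeasurable, ?_⟩
  rw [HasFiniteIntegral, lintegral_eq_tsum_unitSquare, ← lintegral_tsum]
  · calc ∫⁻ z in unitSquare 0, ∑' p, ‖f (z + latticePt p)‖ₑ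
        ≤ ∫⁻ z in unitSquare 0, ENNReal.ofReal K := by
          refine lintegral_mono fun z => ?_
          simp_rw [← ofReal_norm]
          rw [← ENNReal.ofReal_tsum_of_nonneg (fun _ => norm_nonneg _) (hs z)]
          exact ENNReal.ofReal_le_ofReal (hK z)
      _ < ⊤ := by simp [volume_unitSquare]
  · exact fun p => (by fun_prop : Continuous fun z => ‖f (z + latticePt p)‖ₑ).aemeasurable

/-- The projection `ℝ² → (ℝ/ℤ)²`. -/
def torusMk : C(Fin 2 → ℝ, UnitAddTorus (Fin 2)) where
  toFun := Pi.map fun _ => QuotientAddGroup.mk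
  continuous_toFun := by
    refine continuous_pi fun i => ?_
    exact (AddCircle.continuous_mk' 1).comp (continuous_apply i)

lemma isQuotientMap_torusMk : Topology.IsQuotientMap torusMk :=
  (IsOpenQuotientMap.piMap fun _ => QuotientAddGroup.isOpenQuotientMap_mk).isQuotientMap

lemma exists_torus_lift (Φ : ℝ × ℝ → ℂ) (hc : Continuous Φ)
    (hper : ∀ z p, Φ (z + latticePt p) = Φ z) :
    ∃ f : C(UnitAddTorus (Fin 2), ℂ), ∀ x : Fin 2 → ℝ, f (torusMk x) = Φ (x 0, x 1) := by
  let Ψ : C(Fin 2 → ℝ, ℂ) := ⟨fun x => Φ (x 0, x 1), by fun_prop⟩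
  have hfac : Function.FactorsThrough Ψ torusMk := by
    intro x y hxy
    have h (i : Fin 2) : ∃ n : ℤ, x i = y i + n := by
      have h1 : ((x i : ℝ) : AddCircle (1 : ℝ)) = (y i : ℝ) := congrFun hxy i
      have h2 : ((x i - y i : ℝ) : AddCircle (1 : ℝ)) = 0 := by
        rw [AddCircle.coe_sub, h1, sub_self]
      obtain ⟨n, hn⟩ := (AddCircle.coe_eq_zero_iff (1 : ℝ)).1 h2
      refine ⟨n, ?_⟩
      simp only [zsmul_eq_mul, mul_one] at hn
      linarith
    obtain ⟨m, hm⟩ := h 0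
    obtain ⟨n, hn⟩ := h 1
    have := hper (y 0, y 1) (m, n)
    simp only [latticePt, Prod.mk_add_mk, ← hm, ← hn] at this
    exact this
  refine ⟨isQuotientMap_torusMk.lift Ψ hfac, fun x => ?_⟩
  exact congrArg (fun F : C(Fin 2 → ℝ, ℂ) => F x) (isQuotientMap_torusMk.lift_comp Ψ hfac)

lemma mFourier_torusMk (n : Fin 2 → ℤ) (x : Fin 2 → ℝ) :
    UnitAddTorus.mFourier n (torusMk x) = ex (n 0 * x 0 + n 1 * x 1) := by
  have h (i : Fin 2) : fourier (n i) (torusMk x i) = ex (n i * x i) := by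
    change fourier (n i) ((x i : ℝ) : AddCircle (1 : ℝ)) = _
    rw [fourier_coe_apply, ex_eq]
    congr 1; push_cast; ring
  simp only [UnitAddTorus.mFourier, ContinuousMap.coe_mk, Fin.prod_univ_two, h, ex_add]

lemma ex_latticePt (m n : ℤ) (z : ℝ × ℝ) (p : ℤ × ℤ) :
    ex (-(m * (z + latticePt p).1 + n * (z + latticePt p).2)) = ex (-(m * z.1 + n * z.2)) := by
  have : -(m * (z + latticePt p).1 + n * (z + latticePt p).2)
      = -(m * z.1 + n * z.2) + ((-(m * p.1 + n * p.2) : ℤ) : ℝ) := by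
    simp only [latticePt, Prod.fst_add, Prod.snd_add]; push_cast; ring
  rw [this, ex_add, ex_int, mul_one]

/-- **Poisson summation** on `ℤ²`, for a continuous integrable function with a continuous
periodization and summable Fourier transform on the lattice. -/
theorem hasSum_poisson (F : ℝ × ℝ → ℂ) (hF : Continuous F) (hi : Integrable F)
    (hΦ : Continuous fun z => ∑' p, F (z + latticePt p))
    (hsum : Summable fun q : ℤ × ℤ => ∫ z : ℝ × ℝ, F z * ex (-(q.1 * z.1 + q.2 * z.2))) :
    HasSum (fun q : ℤ × ℤ => ∫ z : ℝ × ℝ, F z * ex (-(q.1 * z.1 + q.2 * z.2)))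
      (∑' p, F (latticePt p)) := by
  have hper : ∀ z p, (∑' q, F (z + latticePt p + latticePt q)) = ∑' q, F (z + latticePt q) := by
    intro z p
    rw [← (Equiv.addLeft p).tsum_eq fun q => F (z + latticePt q)]
    refine tsum_congr fun q => ?_
    congr 1
    simp [latticePt, add_assoc]
  obtain ⟨f, hf⟩ := exists_torus_lift _ hΦ hper
  have hcoeff (n : Fin 2 → ℤ) : UnitAddTorus.mFourierCoeff f n
      = ∫ z : ℝ × ℝ, F z * ex (-(n 0 * z.1 + n 1 * z.2)) := by
    rw [UnitAddTorus.mFourierCoeff_eq_integral f n 0, integral_eq_integral_tsum]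
    · have hmp := (volume_preserving_finTwoArrow ℝ)
      rw [← hmp.setIntegral_preimage_emb (MeasurableEquiv.finTwoArrow).measurableEmbedding]
      have hset : {x : Fin 2 → ℝ | ∀ i, x i ∈ Set.Ioc ((0 : Fin 2 → ℝ) i) ((0 : Fin 2 → ℝ) i + 1)}
          = MeasurableEquiv.finTwoArrow ⁻¹' unitSquare 0 := by
        ext x
        simp [unitSquare, MeasurableEquiv.finTwoArrow, Fin.forall_fin_two]
      rw [hset]
      refine integral_congr_ae (Eventually.of_forall fun x => ?_)
      change UnitAddTorus.mFourier (-n) (torusMk x) * f (torusMk x)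
        = ∑' p, F ((x 0, x 1) + latticePt p) *
          ex (-(n 0 * ((x 0, x 1) + latticePt p).1 + n 1 * ((x 0, x 1) + latticePt p).2))
      simp_rw [ex_latticePt]
      rw [tsum_mul_right, mFourier_torusMk, hf, mul_comm]
      congr 2
      simp only [Pi.neg_apply]; push_cast; ring
    · refine hi.mono ?_ ?_
      · exact (hF.mul (continuous_ex.comp (by fun_prop))).aestronglyMeasurable
      · exact Eventually.of_forall fun z => by simp
    · exact hF.mul (continuous_ex.comp (by fun_prop))
  have hs : Summable (UnitAddTorus.mFourierCoeff f) := by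
    rw [← (finTwoArrowEquiv ℤ).symm.summable_iff]
    refine hsum.congr fun q => ?_
    simp [hcoeff, finTwoArrowEquiv]
  have key := UnitAddTorus.hasSum_mFourier_series_apply_of_summable hs (torusMk 0)
  rw [hf] at key
  rw [← (finTwoArrowEquiv ℤ).symm.hasSum_iff] at key
  convert key using 1
  · ext q
    simp [hcoeff, finTwoArrowEquiv, mFourier_torusMk]
  · refine tsum_congr fun p => ?_
    congr 1
    ext <;> simp

/-- `e` is a Bessel family with bound `B`. -/
def IsBessel {ι H : Type*} [NormedAddCommGroup H] [InnerProductSpace ℂ H] (e : ι → H) (B : ℝ) :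
    Prop :=
  ∀ u, (Summable fun i => ‖⟪e i, u⟫_ℂ‖ ^ 2) ∧ ∑' i, ‖⟪e i, u⟫_ℂ‖ ^ 2 ≤ B * ‖u‖ ^ 2

lemma norm_mul_le_weighted (a b : ℂ) {ε : ℝ} (hε : 0 < ε) :
    ‖a * b‖ ≤ ε * ‖a‖ ^ 2 + ε⁻¹ * ‖b‖ ^ 2 := by
  rw [norm_mul]
  have h : 0 ≤ (ε * ‖a‖ - ‖b‖) ^ 2 := sq_nonneg _
  have h2 : ε * (‖a‖ * ‖b‖) ≤ ε * (ε * ‖a‖ ^ 2 + ε⁻¹ * ‖b‖ ^ 2) := by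
    have : ε * (ε * ‖a‖ ^ 2 + ε⁻¹ * ‖b‖ ^ 2) = ε ^ 2 * ‖a‖ ^ 2 + ‖b‖ ^ 2 := by field_simp
    rw [this]
    nlinarith [mul_nonneg hε.le (mul_nonneg (norm_nonneg a) (norm_nonneg b))]
  exact le_of_mul_le_mul_left h2 hε

lemma summable_norm_mul {ι : Type*} {a b : ι → ℂ} (ha : Summable fun i => ‖a i‖ ^ 2)
    (hb : Summable fun i => ‖b i‖ ^ 2) : Summable fun i => ‖a i * b i‖ := by
  refine Summable.of_nonneg_of_le (fun _ => norm_nonneg _)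
    (fun i => norm_mul_le_weighted (a i) (b i) one_pos) ?_
  exact (ha.mul_left _).add (hb.mul_left _)

lemma tsum_norm_mul_le {ι : Type*} {a b : ι → ℂ} (ha : Summable fun i => ‖a i‖ ^ 2)
    (hb : Summable fun i => ‖b i‖ ^ 2) {ε : ℝ} (hε : 0 < ε) :
    ∑' i, ‖a i * b i‖ ≤ ε * ∑' i, ‖a i‖ ^ 2 + ε⁻¹ * ∑' i, ‖b i‖ ^ 2 := by
  rw [← tsum_mul_left, ← tsum_mul_left, ← (ha.mul_left _).tsum_add (hb.mul_left _)]
  exact (summable_norm_mul ha hb).tsum_le_tsum (fun i => norm_mul_le_weighted _ _ hε)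
    ((ha.mul_left _).add (hb.mul_left _))

section Bessel

variable {ι X H : Type*} [TopologicalSpace X] [NormedAddCommGroup H] [InnerProductSpace ℂ H]
  {e : ι → H} {B : ℝ}

lemma IsBessel.summable_inner (he : IsBessel e B) (u : H) :
    Summable fun i => ‖⟪u, e i⟫_ℂ‖ ^ 2 := by
  simpa only [norm_inner_symm u] using (he u).1

lemma IsBessel.tsum_inner_le (he : IsBessel e B) (u : H) :
    ∑' i, ‖⟪u, e i⟫_ℂ‖ ^ 2 ≤ B * ‖u‖ ^ 2 := by
  simpa only [norm_inner_symm u] using (he u).2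

lemma IsBessel.continuous_tsum_mul_inner (he : IsBessel e B) {a : ι → X → ℂ} {K : ℝ}
    (hac : ∀ i, Continuous (a i)) (hs : ∀ x, Summable fun i => ‖a i x‖ ^ 2)
    (hK : ∀ x, ∑' i, ‖a i x‖ ^ 2 ≤ K) {u : X → H} (hu : Continuous u) :
    Continuous fun x => ∑' i, a i x * ⟪u x, e i⟫_ℂ := by
  refine continuous_of_locally_uniform_approx_of_continuousAt fun x₀ U hU => ?_
  obtain ⟨η, hη, hηU⟩ := Metric.mem_uniformity_dist.1 hU
  have hK0 : 0 ≤ K := (tsum_nonneg fun _ => by positivity).trans (hK x₀)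
  set ε : ℝ := η / (2 * (K + 1)) with hεdef
  have hε : 0 < ε := by positivity
  have hεK : ε * K < η / 2 := by
    rw [hεdef, div_mul_eq_mul_div, div_lt_div_iff₀ (by positivity) (by positivity)]
    nlinarith
  have htail := tendsto_tsum_compl_atTop_zero fun i => ‖⟪u x₀, e i⟫_ℂ‖ ^ 2
  obtain ⟨s, hsmall⟩ := (htail.eventually (gt_mem_nhds
    (show (0 : ℝ) < ε * η / 8 by positivity))).exists
  have hD : Tendsto (fun x => B * ‖u x - u x₀‖ ^ 2) (nhds x₀) (nhds 0) := by
    have : Continuous fun x => B * ‖u x - u x₀‖ ^ 2 := by fun_prop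
    simpa using this.tendsto x₀
  refine ⟨_, hD.eventually (gt_mem_nhds (show (0 : ℝ) < ε * η / 8 by positivity)),
    fun x => ∑ i ∈ s, a i x * ⟪u x, e i⟫_ℂ, ?_, fun x hx => hηU ?_⟩
  · refine Continuous.continuousAt (continuous_finsetSum _ fun i _ => (hac i).mul ?_)
    exact hu.inner continuous_const
  have hx' : B * ‖u x - u x₀‖ ^ 2 < ε * η / 8 := hx
  have hb := he.summable_inner (u x)
  have hsn := summable_norm_mul (hs x) hb
  have hinj : Function.Injective (Subtype.val : {i // i ∉ s} → ι) := Subtype.val_injective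
  rw [dist_eq_norm, ← hsn.of_norm.sum_add_tsum_subtype_compl s, add_sub_cancel_left]
  have hbd : ∑' i : {i // i ∉ s}, ‖⟪u x, e i⟫_ℂ‖ ^ 2 < ε * (η / 2) := by
    have hb0 := (he.summable_inner (u x₀)).comp_injective hinj
    have hbd := (he.summable_inner (u x - u x₀)).comp_injective hinj
    calc ∑' i : {i // i ∉ s}, ‖⟪u x, e i⟫_ℂ‖ ^ 2
        ≤ ∑' i : {i // i ∉ s}, (2 * ‖⟪u x₀, e i⟫_ℂ‖ ^ 2 + 2 * ‖⟪u x - u x₀, e i⟫_ℂ‖ ^ 2) := by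
          refine (hb.comp_injective hinj).tsum_le_tsum (fun i => ?_)
            ((hb0.mul_left 2).add (hbd.mul_left 2))
          have h1 : ‖⟪u x, e i⟫_ℂ‖ ≤ ‖⟪u x₀, e i⟫_ℂ‖ + ‖⟪u x - u x₀, e i⟫_ℂ‖ := by
            refine le_trans (le_of_eq ?_) (norm_add_le _ _)
            rw [← inner_add_left, add_sub_cancel]
          have h0 := norm_nonneg ⟪u x, e i⟫_ℂ
          nlinarith [sq_nonneg (‖⟪u x₀, e i⟫_ℂ‖ - ‖⟪u x - u x₀, e i⟫_ℂ‖)]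
      _ = 2 * ∑' i : {i // i ∉ s}, ‖⟪u x₀, e i⟫_ℂ‖ ^ 2
          + 2 * ∑' i : {i // i ∉ s}, ‖⟪u x - u x₀, e i⟫_ℂ‖ ^ 2 := by
          rw [← tsum_mul_left, ← tsum_mul_left]
          exact (hb0.mul_left 2).tsum_add (hbd.mul_left 2)
      _ < 2 * (ε * η / 8) + 2 * (ε * η / 8) := by
          have h3 : ∑' i : {i // i ∉ s}, ‖⟪u x - u x₀, e i⟫_ℂ‖ ^ 2 ≤ B * ‖u x - u x₀‖ ^ 2 :=
            ((he.summable_inner (u x - u x₀)).tsum_subtype_le _ {i | i ∉ s}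
              fun _ => by positivity).trans (he.tsum_inner_le _)
          linarith
      _ = ε * (η / 2) := by ring
  have hak : ∑' i : {i // i ∉ s}, ‖a i x‖ ^ 2 ≤ K :=
    ((hs x).tsum_subtype_le _ {i | i ∉ s} fun _ => by positivity).trans (hK x)
  calc ‖∑' i : {i // i ∉ s}, a i x * ⟪u x, e i⟫_ℂ‖
      ≤ ∑' i : {i // i ∉ s}, ‖a i x * ⟪u x, e i⟫_ℂ‖ :=
        norm_tsum_le_tsum_norm (hsn.comp_injective hinj)
    _ ≤ ε * ∑' i : {i // i ∉ s}, ‖a i x‖ ^ 2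
        + ε⁻¹ * ∑' i : {i // i ∉ s}, ‖⟪u x, e i⟫_ℂ‖ ^ 2 :=
        tsum_norm_mul_le ((hs x).comp_injective hinj) (hb.comp_injective hinj) hε
    _ < ε * K + ε⁻¹ * (ε * (η / 2)) :=
        add_lt_add_of_le_of_lt (mul_le_mul_of_nonneg_left hak hε.le)
          (mul_lt_mul_of_pos_left hbd (inv_pos.2 hε))
    _ = ε * K + η / 2 := by rw [inv_mul_cancel_left₀ hε.ne']
    _ < η := by linarith

end Bessel

/-- The dilation `(a, b) ↦ (αa, βb)` of the plane. -/
def scalePt (α β : ℝ) (z : ℝ × ℝ) : ℝ × ℝ := (α * z.1, β * z.2)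

/-- The enumeration of `αℤ × βℤ` by `ℤ²`. -/
def sepLatticeEquiv {α β : ℝ} (hα : 0 < α) (hβ : 0 < β) : ℤ × ℤ ≃ sepLattice α β :=
  Equiv.ofBijective (fun p => ⟨scalePt α β (latticePt p), p.1, p.2, rfl⟩) <| by
    constructor
    · intro p q h
      have h' := Subtype.ext_iff.1 h
      simp only [scalePt, latticePt, Prod.mk.injEq, mul_eq_mul_left_iff, hα.ne', hβ.ne', or_false,
        Int.cast_inj] at h'
      exact Prod.ext h'.1 h'.2
    · rintro ⟨_, k, l, rfl⟩
      exact ⟨(k, l), rfl⟩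

lemma IsFrameSeq.exists_isBessel {g : L2} {α β : ℝ} (hα : 0 < α) (hβ : 0 < β)
    (h : IsFrameSeq g (sepLattice α β)) :
    ∃ B, IsBessel (fun p : ℤ × ℤ => tf (scalePt α β (latticePt p)) g) B := by
  obtain ⟨A, B, hA, hB, hAB⟩ := h
  refine ⟨B, fun u => ?_⟩
  set W := (Submodule.span ℂ ((fun z => tf z g) '' sepLattice α β)).topologicalClosure with hW
  obtain ⟨y, hy, z, hz, rfl⟩ := W.exists_add_mem_mem_orthogonal u
  have hmem (p : sepLattice α β) : tf (p : ℝ × ℝ) g ∈ W :=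
    Submodule.le_topologicalClosure _ (Submodule.subset_span ⟨p, p.2, rfl⟩)
  have hsum : (Summable fun p : sepLattice α β => ‖⟪tf (p : ℝ × ℝ) g, y⟫_ℂ‖ ^ 2) := by
    by_cases hy0 : y = 0
    · subst hy0; simp
    · by_contra hns
      have h1 := (hAB y hy).1
      rw [tsum_eq_zero_of_not_summable hns] at h1
      have : 0 < A * ‖y‖ ^ 2 := mul_pos hA (pow_pos (norm_pos_iff.2 hy0) 2)
      linarith
  have hnorm : ‖y‖ ^ 2 ≤ ‖y + z‖ ^ 2 := by
    have := norm_add_sq_eq_norm_sq_add_norm_sq_of_inner_eq_zero y z (hz y hy)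
    nlinarith [mul_self_nonneg ‖z‖]
  have hin (p : sepLattice α β) : ⟪tf (p : ℝ × ℝ) g, y + z⟫_ℂ = ⟪tf (p : ℝ × ℝ) g, y⟫_ℂ := by
    rw [inner_add_right, hz _ (hmem p), add_zero]
  have hpt (p : ℤ × ℤ) : ‖⟪tf (scalePt α β (latticePt p)) g, y + z⟫_ℂ‖ ^ 2
      = (fun p : sepLattice α β => ‖⟪tf (p : ℝ × ℝ) g, y⟫_ℂ‖ ^ 2) (sepLatticeEquiv hα hβ p) := by
    simp only [← hin]; rfl
  simp_rw [hpt]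
  refine ⟨(sepLatticeEquiv hα hβ).summable_iff.2 hsum, ?_⟩
  rw [(sepLatticeEquiv hα hβ).tsum_eq fun p : sepLattice α β => ‖⟪tf (p : ℝ × ℝ) g, y⟫_ℂ‖ ^ 2]
  exact (hAB y hy).2.trans (by gcongr)

lemma map_scalePt {α β : ℝ} (hα : 0 < α) (hβ : 0 < β) :
    Measure.map (scalePt α β) (volume : Measure (ℝ × ℝ)) = ENNReal.ofReal (α * β)⁻¹ • volume := by
  change Measure.map (Prod.map (fun x => α * x) fun x => β * x) (volume.prod volume) = _
  rw [← Measure.map_prod_map _ _ (by fun_prop) (by fun_prop), Real.map_volume_mul_left hα.ne',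
    Real.map_volume_mul_left hβ.ne', Measure.prod_smul_left, Measure.prod_smul_right, smul_smul,
    ← ENNReal.ofReal_mul (abs_nonneg _), ← abs_mul, ← mul_inv, abs_of_pos (by positivity)]
  rfl

lemma measurableEmbedding_scalePt {α β : ℝ} (hα : 0 < α) (hβ : 0 < β) :
    MeasurableEmbedding (scalePt α β) :=
  ((MeasurableEquiv.mulLeft₀ α hα.ne').prodCongr
    (MeasurableEquiv.mulLeft₀ β hβ.ne')).measurableEmbedding

lemma integrable_comp_scalePt {α β : ℝ} (hα : 0 < α) (hβ : 0 < β) (f : ℝ × ℝ → ℂ) :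
    Integrable (fun z => f (scalePt α β z)) ↔ Integrable f := by
  change Integrable (f ∘ scalePt α β) ↔ _
  rw [← (measurableEmbedding_scalePt hα hβ).integrable_map_iff, map_scalePt hα hβ]
  exact integrable_smul_measure (by simp; positivity) ENNReal.ofReal_ne_top

lemma integral_comp_scalePt {α β : ℝ} (hα : 0 < α) (hβ : 0 < β) (f : ℝ × ℝ → ℂ) :
    ∫ z, f (scalePt α β z) = ((α * β)⁻¹ : ℝ) * ∫ z, f z := by
  rw [← (measurableEmbedding_scalePt hα hβ).integral_map, map_scalePt hα hβ, integral_smul_measure,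
    ENNReal.toReal_ofReal (by positivity), Complex.real_smul]

lemma norm_inner_tf_add_Tr (g γ : L2) (c : ℝ) (w p : ℝ × ℝ) :
    ‖⟪tf (w + p) γ, Tr c g⟫_ℂ‖ = ‖⟪tf (-p) g, Tr (-c) (tf w γ)⟫_ℂ‖ := by
  obtain ⟨a, b⟩ := p
  rw [add_comm, show (a, b) + w = (a + w.1, b + w.2) from rfl, tf_add, inner_smul_left, norm_mul,
    RCLike.norm_conj, norm_ex, one_mul, inner_tf, norm_inner_symm (tf _ g), inner_Tr, neg_neg]
  have : Mo (-b) (Tr (-a) (Tr c g)) = ex (c * -b + a * b) • Tr c (tf (-(a, b)) g) := by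
    rw [Tr_Tr, add_comm (-a), ← Tr_Tr, Mo_Tr, Mo_Tr, Tr_smul, smul_smul, ex_add]
    congr 2
    ring_nf
  rw [this, inner_smul_right, norm_mul, norm_ex, one_mul]

lemma inner_tf_add (g h : L2) (w p : ℝ × ℝ) :
    ⟪h, tf (w + p) g⟫_ℂ = ex (-(w.2 * p.1)) * ⟪Mo (-w.2) (Tr (-w.1) h), tf p g⟫_ℂ := by
  obtain ⟨a, b⟩ := w
  obtain ⟨c, d⟩ := p
  rw [Prod.mk_add_mk, tf_add, inner_smul_right, ← inner_conj_symm h, inner_tf, inner_conj_symm]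

set_option maxHeartbeats 1000000 in
/-- The fundamental identity of Gabor analysis: a sum over `αℤ × βℤ` equals a sum over the adjoint
lattice. -/
theorem hasSum_fundamental_identity {g : L2} {α β : ℝ} (hα : 0 < α) (hβ : 0 < β) {B : ℝ}
    (hB : IsBessel (fun p : ℤ × ℤ => tf (scalePt α β (latticePt p)) g) B) (γ h : L2) (c : ℝ)
    (hsum : Summable fun q : ℤ × ℤ => (((α * β)⁻¹ : ℝ) : ℂ) *
      (⟪tf (q.2 / β, -(q.1 / α)) γ, g⟫_ℂ * ⟪h, tf (q.2 / β, -(q.1 / α)) (Tr c g)⟫_ℂ)) :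
    HasSum (fun q : ℤ × ℤ => (((α * β)⁻¹ : ℝ) : ℂ) *
      (⟪tf (q.2 / β, -(q.1 / α)) γ, g⟫_ℂ * ⟪h, tf (q.2 / β, -(q.1 / α)) (Tr c g)⟫_ℂ))
      (∑' p : ℤ × ℤ, ⟪tf (scalePt α β (latticePt p)) γ, Tr c g⟫_ℂ *
        ⟪h, tf (scalePt α β (latticePt p)) g⟫_ℂ) := by
  set F : ℝ × ℝ → ℂ := fun z => ⟪tf z γ, Tr c g⟫_ℂ * ⟪h, tf z g⟫_ℂ with hFdef
  set G : ℝ × ℝ → ℂ := fun z => F (scalePt α β z) with hGdef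
  have hscale : Continuous (scalePt α β) := by unfold scalePt; fun_prop
  have hF : Continuous F :=
    ((continuous_tf γ).inner continuous_const).mul (continuous_const.inner (continuous_tf g))
  have hG : Continuous G := hF.comp hscale
  have hadd (z : ℝ × ℝ) (p : ℤ × ℤ) :
      scalePt α β (z + latticePt p) = scalePt α β z + scalePt α β (latticePt p) := by
    simp [scalePt, mul_add]
  let a : ℤ × ℤ → ℝ × ℝ → ℂ := fun p z => ⟪tf (scalePt α β z + scalePt α β (latticePt p)) γ,
    Tr c g⟫_ℂ * ex (-((scalePt α β z).2 * (scalePt α β (latticePt p)).1))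
  let u : ℝ × ℝ → L2 := fun z => Mo (-(scalePt α β z).2) (Tr (-(scalePt α β z).1) h)
  have hterm (z : ℝ × ℝ) (p : ℤ × ℤ) :
      G (z + latticePt p) = a p z * ⟪u z, tf (scalePt α β (latticePt p)) g⟫_ℂ := by
    simp only [hGdef, hFdef, hadd, inner_tf_add g h, a, u, mul_assoc]
  have hac (p : ℤ × ℤ) : Continuous (a p) := by
    have h1 : Continuous fun z => tf (scalePt α β z + scalePt α β (latticePt p)) γ :=
      (continuous_tf γ).comp (hscale.add continuous_const)
    exact (h1.inner continuous_const).mul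
      (continuous_ex.comp ((continuous_snd.comp hscale).mul continuous_const).neg)
  have hu : Continuous u :=
    continuous_Mo_uncurry.comp ((continuous_snd.comp hscale).neg.prodMk
      ((continuous_Tr h).comp (continuous_fst.comp hscale).neg))
  have hun (z : ℝ × ℝ) : ‖u z‖ = ‖h‖ := by simp only [u, norm_Mo, norm_Tr]
  have han (p : ℤ × ℤ) (z : ℝ × ℝ) : ‖a p z‖ ^ 2 =
      (fun p => ‖⟪tf (scalePt α β (latticePt p)) g, Tr (-c) (tf (scalePt α β z) γ)⟫_ℂ‖ ^ 2)
        (Equiv.neg _ p) := by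
    have : -scalePt α β (latticePt p) = scalePt α β (latticePt (-p)) := by
      simp [scalePt, latticePt]
    simp only [a, norm_mul, norm_ex, mul_one, norm_inner_tf_add_Tr, this, Equiv.neg_apply]
  have hs (z : ℝ × ℝ) : Summable fun p => ‖a p z‖ ^ 2 := by
    simp_rw [han]
    exact (Equiv.neg (ℤ × ℤ)).summable_iff.2 (hB _).1
  have hK (z : ℝ × ℝ) : ∑' p, ‖a p z‖ ^ 2 ≤ B * ‖γ‖ ^ 2 := by
    simp_rw [han]
    rw [(Equiv.neg (ℤ × ℤ)).tsum_eq fun p =>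
      ‖⟪tf (scalePt α β (latticePt p)) g, Tr (-c) (tf (scalePt α β z) γ)⟫_ℂ‖ ^ 2]
    refine (hB _).2.trans ?_
    rw [norm_Tr, norm_tf]
  have hint : Integrable F := by
    rw [← integrable_comp_scalePt hα hβ]
    refine integrable_of_tsum_le G hG (B * ‖γ‖ ^ 2 + B * ‖h‖ ^ 2) (fun z => ?_) fun z => ?_
    · simp_rw [hterm]
      exact summable_norm_mul (hs z) (hB.summable_inner (u z))
    · simp_rw [hterm]
      refine (tsum_norm_mul_le (hs z) (hB.summable_inner (u z)) one_pos).trans ?_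
      have h1 := hK z
      have h2 := hB.tsum_inner_le (u z)
      rw [hun] at h2
      linarith
  have hΦ : Continuous fun z => ∑' p, G (z + latticePt p) := by
    simp_rw [hterm]
    exact hB.continuous_tsum_mul_inner hac hs hK hu
  have hcoeff (q : ℤ × ℤ) : ∫ z : ℝ × ℝ, G z * ex (-(q.1 * z.1 + q.2 * z.2))
      = (((α * β)⁻¹ : ℝ) : ℂ) *
      (⟪tf (q.2 / β, -(q.1 / α)) γ, g⟫_ℂ * ⟪h, tf (q.2 / β, -(q.1 / α)) (Tr c g)⟫_ℂ) := by
    rw [← integral_inner_tf_mul (Tr c g) g h γ _ _ hint, ← integral_comp_scalePt hα hβ]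
    refine integral_congr_ae (Eventually.of_forall fun z => ?_)
    simp only [hGdef, hFdef, scalePt]
    congr 3
    field_simp
  simp_rw [← hcoeff] at hsum ⊢
  exact hasSum_poisson G hG ((integrable_comp_scalePt hα hβ F).2 hint) hΦ hsum

lemma tf_sub_modulation (a b s : ℝ) (f : L2) :
    tf (a, b - s) f = ex (a * s) • Mo (-s) (tf (a, b) f) := by
  simp only [tf]
  rw [Mo_Tr, smul_smul, ← ex_add, Mo_Mo]
  have h1 : a * s + a * -s = 0 := by ring
  have h2 : -s + b = b - s := by ring
  rw [h1, ex_zero, one_smul, h2]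

lemma tf_Tr (a b c : ℝ) (f : L2) : tf (a, b) (Tr c f) = ex (c * b) • Tr c (tf (a, b) f) := by
  simp only [tf]
  rw [Mo_Tr, Tr_smul, Tr_Tr, Tr_Tr, add_comm]

/-- The `s`-th coset contribution to the dual side of the fundamental identity. -/
lemma inner_mul_inner_coset (g γ h : L2) (a b c s t : ℝ) (hb : ex (c * b) = 1)
    (ht : c * s = t) :
    ⟪tf (a, b - s) γ, g⟫_ℂ * ⟪h, tf (a, b - s) (Tr c g)⟫_ℂ
      = ex (-t) * (⟪tf (a, b) γ, Mo s g⟫_ℂ * ⟪Mo s (Tr (-c) h), tf (a, b) g⟫_ℂ) := by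
  have hph : ex (c * (b - s)) = ex (-t) := by
    rw [show c * (b - s) = c * b + -t by rw [← ht]; ring, ex_add, hb, one_mul]
  rw [tf_Tr, hph, tf_sub_modulation, tf_sub_modulation, Tr_smul, inner_smul_left, inner_smul_right,
    inner_smul_right, inner_Mo, neg_neg, inner_Mo s, inner_Tr, neg_neg]
  linear_combination ex (-t) * (⟪tf (a, b) γ, Mo s g⟫_ℂ * ⟪h, Tr c (Mo (-s) (tf (a, b) g))⟫_ℂ)
    * conj_ex_mul_ex (a * s)

lemma hasSum_of_hasSum_cosets {D : ℤ × ℤ → ℂ} {ν : ℕ} (hν : 1 ≤ ν) {S : ℕ → ℂ}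
    (h : ∀ s < ν, HasSum (fun kl : ℤ × ℤ => D (ν * -kl.2 + s, kl.1)) (S s)) :
    HasSum D (∑ s ∈ Finset.range ν, S s) := by
  have hν0 : (ν : ℤ) ≠ 0 := by omega
  have hE (s : ℕ) (hs : s < ν) : HasSum (fun q : ℤ × ℤ => if q.1 % ν = s then D q else 0) (S s) := by
    have hinj : Function.Injective fun kl : ℤ × ℤ => ((ν * -kl.2 + s, kl.1) : ℤ × ℤ) := by
      intro p q hpq
      simp only [Prod.mk.injEq, add_left_inj, mul_eq_mul_left_iff, neg_inj, hν0, or_false] at hpq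
      exact Prod.ext hpq.2 hpq.1
    rw [← hinj.hasSum_iff]
    · have hmod : ((s : ℕ) : ℤ) % ν = s := Int.emod_eq_of_lt (by omega) (by omega)
      refine (h s hs).congr_fun fun kl => ?_
      simp only [Function.comp_apply, Int.mul_add_emod_self_left, hmod, if_true]
    · intro q hq
      rw [if_neg]
      intro hmod
      refine hq ⟨(q.2, -(q.1 / ν)), Prod.ext ?_ rfl⟩
      simp only [neg_neg, ← hmod]
      exact Int.mul_ediv_add_emod q.1 ν
  have := hasSum_sum (s := Finset.range ν) fun s hs => hE s (Finset.mem_range.1 hs)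
  refine this.congr_fun fun q => ?_
  have h0 := Int.emod_nonneg q.1 hν0
  have h1 := Int.emod_lt_of_pos q.1 (show (0 : ℤ) < ν by omega)
  lift q.1 % (ν : ℤ) to ℕ using h0 with r
  simp only [Nat.cast_inj]
  rw [Finset.sum_ite_eq, if_pos (Finset.mem_range.2 (by omega))]

/-- (ii) ⇒ (i) of Theorem 4.4: if
`(αβ)⁻¹ S_{γ,g} M_{s/α} g = δ_{s,0} g` for `s = 0, …, ν-1`, then `T_{α/ν} g ∈ 𝒢`. -/
theorem statement_11 (g : L2) (hg : InS0 g) (α β : ℝ) (hα : 0 < α) (hβ : 0 < β)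
    (hframe : IsFrameSeq g (sepLattice α β)) (γ : L2) (hγ : IsDualWindow g γ α β)
    (ν : ℕ) (hν : 1 ≤ ν)
    (hP : ∀ s : ℕ, s < ν →
      HasSum (fun kl : ℤ × ℤ =>
        ((((α * β)⁻¹ : ℝ) : ℂ) *
            ⟪tf ((kl.1 : ℝ) / β, (kl.2 : ℝ) * (ν : ℝ) / α) γ, Mo ((s : ℝ) / α) g⟫_ℂ)
          • tf ((kl.1 : ℝ) / β, (kl.2 : ℝ) * (ν : ℝ) / α) g)
        (if s = 0 then g else 0)) :
    Tr (α / ν) g ∈ gaborSpan g (sepLattice α β) := by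
  have hν0 : (ν : ℝ) ≠ 0 := by positivity
  obtain ⟨B, hB⟩ := hframe.exists_isBessel hα hβ
  set W := (Submodule.span ℂ ((fun z => tf z g) '' sepLattice α β)).topologicalClosure with hW
  change Tr (α / ν) g ∈ W
  rw [← W.orthogonal_orthogonal, Submodule.mem_orthogonal]
  intro h hh
  have hzero (p : ℤ × ℤ) : ⟪h, tf (scalePt α β (latticePt p)) g⟫_ℂ = 0 := by
    refine (Submodule.mem_orthogonal' _ _).1 hh _ (Submodule.le_topologicalClosure _ ?_)
    exact Submodule.subset_span ⟨_, ⟨p.1, p.2, rfl⟩, rfl⟩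
  have hdual := hasSum_of_hasSum_cosets (D := fun q : ℤ × ℤ => (((α * β)⁻¹ : ℝ) : ℂ) *
      (⟪tf (q.2 / β, -(q.1 / α)) γ, g⟫_ℂ * ⟪h, tf (q.2 / β, -(q.1 / α)) (Tr (α / ν) g)⟫_ℂ)) hν
      (S := fun s => if s = 0 then ⟪h, Tr (α / ν) g⟫_ℂ else 0) fun s hs => by
    have hψ := ((innerSL ℂ (Mo (s / α) (Tr (-(α / ν)) h))).hasSum (hP s hs)).mul_left
      (ex (-(s / ν)))
    have hval : (ex (-(s / ν)) * innerSL ℂ (Mo (s / α) (Tr (-(α / ν)) h)) (if s = 0 then g else 0))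
        = if s = 0 then ⟪h, Tr (α / ν) g⟫_ℂ else 0 := by
      split_ifs with hs0
      · subst hs0
        simp only [Nat.cast_zero, zero_div, neg_zero, ex_zero, one_mul, innerSL_apply_apply]
        rw [inner_Mo, inner_Tr, neg_neg, neg_zero, Mo_zero]
      · simp
    rw [hval] at hψ
    refine hψ.congr_fun fun kl => ?_
    have hfreq : -(((ν * -kl.2 + s : ℤ) : ℝ) / α) = (kl.2 : ℝ) * ν / α - s / α := by
      push_cast; ring
    simp only [hfreq, innerSL_apply_apply, inner_smul_right]
    rw [inner_mul_inner_coset g γ h _ _ (α / ν) (s / α) (s / ν) ?_ ?_]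
    · ring
    · rw [show α / ν * ((kl.2 : ℝ) * ν / α) = kl.2 by field_simp, ex_int]
    · field_simp
  have hsum := hasSum_fundamental_identity hα hβ hB γ h (α / ν) hdual.summable
  simp only [hzero, mul_zero, tsum_zero] at hsum
  have := hdual.unique hsum
  rwa [Finset.sum_ite_eq', if_pos (Finset.mem_range.2 (by omega))] at this

end
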